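/- arXiv:2204.11289 — 10 statements merged into one kernel-verified Lean document; each statement's English description precedes it below -/
import Mathlib

section
/- Let ψ : ℕ →. ℕ be a linearly universal partial recursive function. Define φ : ℕ → ℕ →. ℕ by φ e x := ψ(u₀(e)·x + u₁(e)). Then φ is an admissible enumeration of the partial recursive functions: (i) the uncurried map (e, x) ↦ φ e x is partial recursive; (ii) for every partial recursive θ : ℕ →. ℕ there is e ∈ ℕ with φ e = θ; and (iii) for every partial recursive χ : ℕ → ℕ →. ℕ there is a total computable g : ℕ → ℕ with φ (g m) x = χ m x for all m, x ∈ ℕ. -/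
/-- A partial recursive function `ψ : ℕ →. ℕ` is *linearly universal* if for every
partial recursive `θ : ℕ →. ℕ` there are `a b : ℕ` with `ψ (a * x + b) = θ x` for all `x`. -/
def LinearlyUniversal (ψ : ℕ →. ℕ) : Prop :=
  Partrec ψ ∧ ∀ θ : ℕ →. ℕ, Partrec θ → ∃ a b : ℕ, ∀ x : ℕ, ψ (a * x + b) = θ x

theorem lu_pow : Primrec (fun n : ℕ => 2 ^ n) := by
  have h : Primrec₂ (fun (_ : ℕ) (p : ℕ) => 2 * p) :=
    Primrec.nat_mul.comp (Primrec.const 2) Primrec.snd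
  refine (Primrec.nat_iterate Primrec.id (Primrec.const 1) h).of_eq fun n => ?_
  induction n with
  | zero => rfl
  | succ k ih =>
    simp only [id] at ih ⊢
    rw [Function.iterate_succ_apply', ih, pow_succ]; ring

theorem lu_not_dvd (k b n : ℕ) (h : k < n) : ¬ 2 ^ n ∣ 2 ^ k * (2 * b + 1) := by
  intro hd
  have h1 : 2 ^ k * 2 ∣ 2 ^ k * (2 * b + 1) :=
    (by rw [← pow_succ]; exact pow_dvd_pow 2 h : 2 ^ k * 2 ∣ 2 ^ n).trans hd
  have h2 := Nat.dvd_of_mul_dvd_mul_left (by positivity) h1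
  omega

theorem lu_unique (a b c d : ℕ) (h : 2 ^ a * (2 * b + 1) = 2 ^ c * (2 * d + 1)) :
    a = c ∧ b = d := by
  have hac : a = c := by
    rcases lt_trichotomy a c with hl | he | hl
    · exact absurd (h ▸ Dvd.intro _ rfl) (lu_not_dvd a b c hl)
    · exact he
    · exact absurd (h ▸ Dvd.intro _ rfl) (lu_not_dvd c d a hl)
  subst hac
  have := Nat.eq_of_mul_eq_mul_left (by positivity) h
  exact ⟨rfl, by omega⟩

theorem lu_u0 (u₀ u₁ : ℕ → ℕ) (hu : ∀ e : ℕ, e + 1 = 2 ^ u₀ e * (2 * u₁ e + 1)) :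
    Primrec u₀ := by
  have hp : PrimrecRel (fun e k : ℕ => (e + 1) % 2 ^ k = 0) :=
    Primrec.eq.comp
      (Primrec.nat_mod.comp (Primrec.succ.comp Primrec.fst) (lu_pow.comp Primrec.snd))
      (Primrec.const 0)
  refine (Primrec.nat_findGreatest Primrec.id hp).of_eq fun e => ?_
  rw [Nat.findGreatest_eq_iff]
  refine ⟨?_, fun _ => ?_, fun n hn _ hm => ?_⟩
  · have h1 : 2 ^ u₀ e ≤ e + 1 := Nat.le_of_dvd (by omega) (Dvd.intro _ (hu e).symm)
    have h2 : u₀ e < 2 ^ u₀ e := Nat.lt_two_pow_self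
    simp only [id]; omega
  · exact Nat.mod_eq_zero_of_dvd (Dvd.intro _ (hu e).symm)
  · have h := Nat.dvd_of_mod_eq_zero hm
    rw [hu e] at h
    exact lu_not_dvd _ _ _ hn h

theorem lu_u1 (u₀ u₁ : ℕ → ℕ) (hu : ∀ e : ℕ, e + 1 = 2 ^ u₀ e * (2 * u₁ e + 1)) :
    Primrec u₁ := by
  refine (Primrec.nat_div.comp (Primrec.nat_div.comp Primrec.succ
    (lu_pow.comp (lu_u0 u₀ u₁ hu))) (Primrec.const 2)).of_eq fun e => ?_
  have : (e + 1) / 2 ^ u₀ e = 2 * u₁ e + 1 :=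
    Nat.div_eq_of_eq_mul_right (by positivity) (hu e)
  simp only [Nat.succ_eq_add_one]
  rw [this]; omega

theorem lu_code (u₀ u₁ : ℕ → ℕ) (hu : ∀ e : ℕ, e + 1 = 2 ^ u₀ e * (2 * u₁ e + 1)) (a b : ℕ) :
    u₀ (2 ^ a * (2 * b + 1) - 1) = a ∧ u₁ (2 ^ a * (2 * b + 1) - 1) = b := by
  have hpos : 0 < 2 ^ a * (2 * b + 1) := by positivity
  have h := hu (2 ^ a * (2 * b + 1) - 1)
  rw [Nat.sub_add_cancel hpos] at h
  have := lu_unique _ _ _ _ h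
  exact ⟨this.1.symm, this.2.symm⟩

/-- The enumeration of partial recursive functions induced by a linearly universal
partial recursive function is admissible. -/
theorem enumeration_from_linearly_universal_is_admissible
    (ψ : ℕ →. ℕ) (hψ : LinearlyUniversal ψ)
    (u₀ u₁ : ℕ → ℕ) (hu : ∀ e : ℕ, e + 1 = 2 ^ u₀ e * (2 * u₁ e + 1)) :
    Partrec₂ (fun (e x : ℕ) => ψ (u₀ e * x + u₁ e)) ∧
    (∀ θ : ℕ →. ℕ, Partrec θ →
      ∃ e : ℕ, (fun x : ℕ => ψ (u₀ e * x + u₁ e)) = θ) ∧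
    (∀ χ : ℕ → ℕ →. ℕ, Partrec₂ χ →
      ∃ g : ℕ → ℕ, Computable g ∧
        ∀ m x : ℕ, ψ (u₀ (g m) * x + u₁ (g m)) = χ m x) := by
  obtain ⟨hr, hlin⟩ := hψ
  have h0 := lu_u0 u₀ u₁ hu
  have h1 := lu_u1 u₀ u₁ hu
  refine ⟨?_, ?_, ?_⟩
  · have h : Primrec (fun p : ℕ × ℕ => u₀ p.1 * p.2 + u₁ p.1) :=
      Primrec.nat_add.comp (Primrec.nat_mul.comp (h0.comp Primrec.fst) Primrec.snd)
        (h1.comp Primrec.fst)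
    exact hr.comp h.to_comp
  · intro θ hθ
    obtain ⟨a, b, hab⟩ := hlin θ hθ
    refine ⟨2 ^ a * (2 * b + 1) - 1, funext fun x => ?_⟩
    obtain ⟨e0, e1⟩ := lu_code u₀ u₁ hu a b
    rw [e0, e1, hab]
  · intro χ hχ
    have hθ : Partrec (fun n : ℕ => χ (u₀ (n - 1)) (u₁ (n - 1))) :=
      Partrec₂.comp hχ (h0.comp Primrec.pred).to_comp (h1.comp Primrec.pred).to_comp
    obtain ⟨a, b, hab⟩ := hlin _ hθ
    refine ⟨fun m => 2 ^ (a * (2 ^ m * 2)) * (2 * (a * 2 ^ m + b) + 1) - 1, ?_, ?_⟩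
    · have p1 : Primrec (fun m : ℕ => 2 ^ (a * (2 ^ m * 2))) :=
        lu_pow.comp (Primrec.nat_mul.comp (Primrec.const a)
          (Primrec.nat_mul.comp lu_pow (Primrec.const 2)))
      have p2 : Primrec (fun m : ℕ => 2 * (a * 2 ^ m + b) + 1) :=
        Primrec.succ.comp (Primrec.nat_mul.comp (Primrec.const 2)
          (Primrec.nat_add.comp (Primrec.nat_mul.comp (Primrec.const a) lu_pow)
            (Primrec.const b)))
      exact (Primrec.pred.comp (Primrec.nat_mul.comp p1 p2)).to_comp
    · intro m x
      obtain ⟨e0, e1⟩ := lu_code u₀ u₁ hu (a * (2 ^ m * 2)) (a * 2 ^ m + b)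
      obtain ⟨f0, f1⟩ := lu_code u₀ u₁ hu m x
      have h := hab (2 ^ m * (2 * x + 1))
      simp only [f0, f1] at h
      simp only [e0, e1]
      rw [← h]
      congr 1
      ring
end

section
/- Let ψ₀ : ℕ →. ℕ be a linearly universal partial recursive function. Define ψ : ℕ →. ℕ by ψ(e) := ψ₀(u₀(e)·e + u₁(e)), where u₀(e), u₁(e) are the unique natural numbers with e + 1 = 2^{u₀(e)}·(2·u₁(e) + 1). Then ψ is partial recursive and linearly universal. -/
/-- The diagonal of the enumeration induced by a linearly universal partial recursive
function is again linearly universal. -/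
theorem diagonal_of_linearly_universal_is_linearly_universal
    (ψ₀ : ℕ →. ℕ) (hψ₀ : LinearlyUniversal ψ₀)
    (u₀ u₁ : ℕ → ℕ) (hu : ∀ e : ℕ, e + 1 = 2 ^ u₀ e * (2 * u₁ e + 1)) :
    Partrec (fun e : ℕ => ψ₀ (u₀ e * e + u₁ e)) ∧
    LinearlyUniversal (fun e : ℕ => ψ₀ (u₀ e * e + u₁ e)) := by
  have hpow : Primrec (fun k : ℕ => 2 ^ k) := by
    refine (Primrec.nat_iterate (f := fun k : ℕ => k) (g := fun _ : ℕ => 1)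
      (h := fun _ b : ℕ => 2 * b) Primrec.id (Primrec.const 1)
      (Primrec.nat_mul.comp (Primrec.const 2) Primrec.snd)).of_eq fun k => ?_
    induction k with
    | zero => rfl
    | succ n ih => rw [Function.iterate_succ_apply', ih, pow_succ]; ring
  have h0 : Primrec u₀ := by
    have hp : PrimrecRel (fun e k : ℕ => (e + 1) % 2 ^ k = 0) :=
      Primrec.eq.comp (Primrec.nat_mod.comp (Primrec.succ.comp Primrec.fst)
        (hpow.comp Primrec.snd)) (Primrec.const 0)
    refine (Primrec.nat_findGreatest (f := fun e : ℕ => e) Primrec.id hp).of_eq fun e => ?_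
    rw [Nat.findGreatest_eq_iff]
    refine ⟨?_, fun _ => ?_, fun n hn _ h => ?_⟩
    · have h1 : u₀ e < 2 ^ u₀ e := Nat.lt_two_pow_self
      have h2 := hu e
      have h3 : 2 ^ u₀ e * 1 ≤ 2 ^ u₀ e * (2 * u₁ e + 1) := Nat.mul_le_mul_left _ (by omega)
      omega
    · exact Nat.mod_eq_zero_of_dvd (Dvd.intro _ (hu e).symm)
    · have h1 : 2 ^ (u₀ e + 1) ∣ e + 1 :=
        (pow_dvd_pow 2 hn).trans (Nat.dvd_of_mod_eq_zero h)
      rw [hu e, pow_succ] at h1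
      have := Nat.dvd_of_mul_dvd_mul_left (by positivity) h1
      omega
  have h1 : Primrec u₁ := by
    refine (Primrec.nat_div.comp (Primrec.nat_div.comp Primrec.succ (hpow.comp h0))
      (Primrec.const 2)).of_eq fun e => ?_
    change (e + 1) / 2 ^ u₀ e / 2 = u₁ e
    have h2 : (e + 1) / 2 ^ u₀ e = 2 * u₁ e + 1 :=
      Nat.div_eq_of_eq_mul_right (by positivity) (hu e)
    omega
  have hP : Partrec (fun e : ℕ => ψ₀ (u₀ e * e + u₁ e)) :=
    hψ₀.1.comp (Primrec.nat_add.comp (Primrec.nat_mul.comp h0 Primrec.id) h1).to_comp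
  refine ⟨hP, hP, fun θ hθ => ?_⟩
  obtain ⟨a, b, hab⟩ := hψ₀.2 θ hθ
  refine ⟨2 * a, 2 * b, fun x => ?_⟩
  rw [← hab x]
  have he : 2 * a * x + 2 * b = 2 * (a * x + b) := by ring
  rw [he]
  generalize a * x + b = y
  have h2 := hu (2 * y)
  have h3 : u₀ (2 * y) = 0 := by
    rcases hk : u₀ (2 * y) with _ | k
    · rfl
    · rw [hk, pow_succ, mul_comm (2 ^ k) 2, mul_assoc] at h2
      omega
  have h4 : u₁ (2 * y) = y := by
    rw [h3] at h2
    omega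
  simp only [h3, h4, zero_mul, zero_add]
end

section
/- Suppose ψ, χ : ℕ →. ℕ are partial recursive functions such that ψ(n) = χ(n) (equality in Part ℕ) for all but finitely many n ∈ ℕ. Then ψ is linearly universal if and only if χ is linearly universal. -/
theorem linUniv_aux (ψ χ : ℕ →. ℕ) (hχ : Partrec χ)
    (hfin : {n : ℕ | ψ n ≠ χ n}.Finite) (h : LinearlyUniversal ψ) : LinearlyUniversal χ := by
  refine ⟨hχ, fun θ hθ => ?_⟩
  obtain ⟨N, hN⟩ := hfin.bddAbove
  have hN' : ∀ n, N < n → ψ n = χ n := by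
    intro n hn
    by_contra hne
    exact absurd (hN hne) (by omega)
  have hsub : Computable (fun x : ℕ => x - (N + 2)) :=
    (Primrec.nat_sub.comp Primrec.id (Primrec.const (N + 2))).to_comp
  have hc : Computable (fun x : ℕ => decide (x < N + 2)) :=
    (Primrec.nat_lt.comp Primrec.id (Primrec.const (N + 2))).decide.to_comp
  have hp : Partrec (fun x : ℕ => cond (decide (x < N + 2)) (Part.some x) (θ (x - (N + 2)))) :=
    Partrec.cond hc Computable.id.partrec (hθ.comp hsub)
  obtain ⟨a, b, hab⟩ := h.2 _ hp
  have ha : 1 ≤ a := by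
    rcases Nat.eq_zero_or_pos a with rfl | h
    · have h0 := hab 0
      have h1 := hab 1
      simp at h0 h1
      rw [h0] at h1
      simp at h1
    · exact h
  refine ⟨a, a * (N + 2) + b, fun x => ?_⟩
  have h1 := hab (x + (N + 2))
  have e : a * (x + (N + 2)) + b = a * x + (a * (N + 2) + b) := by ring
  rw [e, hN' _ (by nlinarith)] at h1
  simpa using h1

/-- Changing finitely many values of a partial recursive function preserves
(and reflects) linear universality. -/
theorem finitely_many_changes_preserves_linear_universality
    (ψ χ : ℕ →. ℕ) (hψ : Partrec ψ) (hχ : Partrec χ)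
    (hfin : {n : ℕ | ψ n ≠ χ n}.Finite) :
    LinearlyUniversal ψ ↔ LinearlyUniversal χ := by
  refine ⟨linUniv_aux ψ χ hχ hfin, linUniv_aux χ ψ hψ ?_⟩
  simpa only [ne_comm] using hfin
end

section
/- There exists a map Ψ : ℕ → ℕ →. ℕ such that: (i) the uncurried map (e, x) ↦ Ψ e x is partial recursive; (ii) Ψ e is a linearly universal partial recursive function for every e ∈ ℕ; and (iii) for every linearly universal partial recursive function χ : ℕ →. ℕ there exists e ∈ ℕ with Ψ e = χ. In other words, there is an effective enumeration of exactly the linearly universal partial recursive functions. -/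
open Nat.Partrec (Code)

/-- Base function: on `2 ^ c * (2 * x + 1)` it runs the program `c` on `x`. -/
def baseV (y : ℕ) : Part ℕ :=
  (Nat.rfind fun c => Part.some (y / 2 ^ c % 2 == 1)).bind fun c =>
    Code.eval (Denumerable.ofNat Code c) (y / 2 ^ (c + 1))

theorem primrec_pow_aux : Primrec₂ ((· ^ ·) : ℕ → ℕ → ℕ) :=
  Primrec₂.unpaired'.1 Nat.Primrec.pow

theorem baseV_partrec : Partrec baseV := by
  have hp : Primrec fun p : ℕ × ℕ => (p.1 / 2 ^ p.2 % 2 == 1) :=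
    Primrec.beq.comp (Primrec.nat_mod.comp (Primrec.nat_div.comp Primrec.fst
      (primrec_pow_aux.comp (Primrec.const 2) Primrec.snd)) (Primrec.const 2)) (Primrec.const 1)
  have hq : Primrec fun p : ℕ × ℕ => p.1 / 2 ^ (p.2 + 1) :=
    Primrec.nat_div.comp Primrec.fst
      (primrec_pow_aux.comp (Primrec.const 2) (Primrec.succ.comp Primrec.snd))
  have h1 : Partrec₂ fun y c : ℕ => Part.some (y / 2 ^ c % 2 == 1) := hp.to_comp.partrec
  have h2 : Partrec₂ fun y c : ℕ =>
      Code.eval (Denumerable.ofNat Code c) (y / 2 ^ (c + 1)) :=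
    Code.eval_part.comp ((Computable.ofNat Code).comp Computable.snd) hq.to_comp
  exact (Partrec.rfind h1).bind h2

theorem baseV_apply (c x : ℕ) :
    baseV (2 ^ (c + 1) * x + 2 ^ c) = Code.eval (Denumerable.ofNat Code c) x := by
  have h : (Nat.rfind fun k => Part.some ((2 ^ (c + 1) * x + 2 ^ c) / 2 ^ k % 2 == 1))
      = Part.some c := by
    refine Part.eq_some_iff.2 (Nat.mem_rfind.2 ⟨?_, ?_⟩)
    · have : (2 ^ (c + 1) * x + 2 ^ c) / 2 ^ c = 2 * x + 1 := by
        rw [show 2 ^ (c + 1) * x + 2 ^ c = 2 ^ c * (2 * x + 1) by ring]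
        exact Nat.mul_div_cancel_left _ (by positivity)
      rw [this]
      simp
    · intro m hm
      obtain ⟨d, rfl⟩ := Nat.exists_eq_add_of_lt hm
      have : (2 ^ (m + d + 1 + 1) * x + 2 ^ (m + d + 1)) / 2 ^ m = 2 * (2 ^ d * (2 * x + 1)) := by
        rw [show 2 ^ (m + d + 1 + 1) * x + 2 ^ (m + d + 1)
          = 2 ^ m * (2 * (2 ^ d * (2 * x + 1))) by ring]
        exact Nat.mul_div_cancel_left _ (by positivity)
      rw [this]
      simp
  have h2 : (2 ^ (c + 1) * x + 2 ^ c) / 2 ^ (c + 1) = x := by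
    rw [Nat.mul_add_div (by positivity),
      Nat.div_eq_of_lt (Nat.pow_lt_pow_right (by norm_num) (Nat.lt_succ_self c)), add_zero]
  rw [baseV, h, Part.bind_some, h2]

theorem exists_code_aux {θ : ℕ →. ℕ} (h : Partrec θ) :
    ∃ c : ℕ, Code.eval (Denumerable.ofNat Code c) = θ := by
  obtain ⟨c, hc⟩ := Code.exists_code.1 (Partrec.nat_iff.1 h)
  exact ⟨Encodable.encode c, by rw [Denumerable.ofNat_encode, hc]⟩

theorem baseV_lu : LinearlyUniversal baseV := by
  refine ⟨baseV_partrec, fun θ hθ => ?_⟩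
  obtain ⟨c, rfl⟩ := exists_code_aux hθ
  exact ⟨2 ^ (c + 1), 2 ^ c, fun x => baseV_apply c x⟩

/-- The enumeration. -/
def enumPsi (e y : ℕ) : Part ℕ :=
  cond (decide (e.unpair.2.unpair.1 ≤ y) &&
      ((y - e.unpair.2.unpair.1) % (e.unpair.1 + 1) == 0))
    (baseV ((y - e.unpair.2.unpair.1) / (e.unpair.1 + 1)))
    (Code.eval (Denumerable.ofNat Code e.unpair.2.unpair.2) y)

theorem enumPsi_partrec : Partrec₂ enumPsi := by
  have hu : Primrec fun p : ℕ × ℕ => p.1.unpair := Primrec.unpair.comp Primrec.fst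
  have ha : Primrec fun p : ℕ × ℕ => p.1.unpair.1 + 1 :=
    Primrec.succ.comp (Primrec.fst.comp hu)
  have hu2 : Primrec fun p : ℕ × ℕ => p.1.unpair.2.unpair :=
    Primrec.unpair.comp (Primrec.snd.comp hu)
  have hb : Primrec fun p : ℕ × ℕ => p.1.unpair.2.unpair.1 := Primrec.fst.comp hu2
  have hc : Primrec fun p : ℕ × ℕ => p.1.unpair.2.unpair.2 := Primrec.snd.comp hu2
  have hs : Primrec fun p : ℕ × ℕ => p.2 - p.1.unpair.2.unpair.1 :=
    Primrec.nat_sub.comp Primrec.snd hb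
  have hcond : Primrec fun p : ℕ × ℕ => (decide (p.1.unpair.2.unpair.1 ≤ p.2) &&
      ((p.2 - p.1.unpair.2.unpair.1) % (p.1.unpair.1 + 1) == 0)) :=
    Primrec.and.comp (Primrec.nat_le.decide.comp hb Primrec.snd)
      (Primrec.beq.comp (Primrec.nat_mod.comp hs ha) (Primrec.const 0))
  exact Partrec.cond hcond.to_comp
    (baseV_partrec.comp (Primrec.nat_div.comp hs ha).to_comp)
    (Code.eval_part.comp ((Computable.ofNat Code).comp hc.to_comp) Computable.snd)

theorem enumPsi_apply (e x : ℕ) :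
    enumPsi e ((e.unpair.1 + 1) * x + e.unpair.2.unpair.1) = baseV x := by
  simp [enumPsi]

/-- There is an effective enumeration of exactly the linearly universal partial
recursive functions. -/
theorem effective_enumeration_of_linearly_universal :
    ∃ Ψ : ℕ → ℕ →. ℕ,
      Partrec₂ Ψ ∧
      (∀ e : ℕ, LinearlyUniversal (Ψ e)) ∧
      (∀ χ : ℕ →. ℕ, LinearlyUniversal χ → ∃ e : ℕ, Ψ e = χ) := by
  refine ⟨enumPsi, enumPsi_partrec, fun e => ⟨?_, fun θ hθ => ?_⟩, fun χ hχ => ?_⟩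
  · exact enumPsi_partrec.comp (Computable.const e) Computable.id
  · obtain ⟨a, b, h⟩ := baseV_lu.2 θ hθ
    refine ⟨(e.unpair.1 + 1) * a, (e.unpair.1 + 1) * b + e.unpair.2.unpair.1, fun x => ?_⟩
    rw [← h x, ← enumPsi_apply e]
    congr 1
    ring
  · obtain ⟨a, b, h⟩ := hχ.2 baseV baseV_partrec
    obtain ⟨c, hc⟩ := exists_code_aux hχ.1
    have ha : a ≠ 0 := by
      rintro rfl
      obtain ⟨p, q, hpq⟩ := baseV_lu.2 (fun n => Part.some n) Computable.id.partrec
      have h0 := hpq 0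
      have h1 := hpq 1
      rw [← h] at h0 h1
      simp only [zero_mul] at h0 h1
      rw [h0] at h1
      exact absurd (Part.some_injective h1) (by norm_num)
    obtain ⟨k, rfl⟩ := Nat.exists_eq_succ_of_ne_zero ha
    refine ⟨Nat.pair k (Nat.pair b c), funext fun y => ?_⟩
    simp only [enumPsi, Nat.unpair_pair, hc]
    by_cases hy : b ≤ y ∧ (y - b) % (k + 1) = 0
    · have hd := Nat.div_add_mod (y - b) (k + 1)
      have : y = (k + 1) * ((y - b) / (k + 1)) + b := by omega
      rw [← h]
      simp only [hy.1, hy.2, Nat.succ_eq_add_one, ← this]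
      simp
    · have : (decide (b ≤ y) && ((y - b) % (k + 1) == 0)) = false := by
        simpa using hy
      rw [this]
      rfl
end

section
/- Let p : ℕ → ℝ satisfy p(n) > 1 for all n, let a, b ∈ ℕ with a ≥ 1, and define q : ℕ → ℝ by q(x) := p(a·x + b). Suppose X : ℕ → ℕ and ψ : ℕ →. ℕ is a linearly universal partial recursive function such that for all x, X(x) ∉ ψ(x) and (↑(X x) : ℝ) < q(x). Define X̃ : ℕ → ℕ by X̃(y) := X(x) if y = a·x + b for some x ∈ ℕ, and X̃(y) := 0 otherwise. Then (↑(X̃ y) : ℝ) < p(y) for all y, and there exists a linearly universal partial recursive ψ̃ : ℕ →. ℕ such that X̃(y) ∉ ψ̃(y) for all y; hence X̃ ∈ LUA(p). -/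
/-- `X ∈ LUA(p)` if `X` is `p`-bounded and avoids some linearly universal partial
recursive function. -/
def LUA (p : ℕ → ℝ) (X : ℕ → ℕ) : Prop :=
  ∃ ψ : ℕ →. ℕ, LinearlyUniversal ψ ∧ ∀ n : ℕ, X n ∉ ψ n ∧ ((X n : ℝ) < p n)

/-- If `q(x) = p(a·x + b)` and `X` witnesses avoidance for `q`, then the transferred
sequence `X̃` witnesses avoidance for `p`, i.e. `X̃ ∈ LUA(p)`. -/
theorem lua_transfer_along_linear_substitution
    (p : ℕ → ℝ) (hp : ∀ n : ℕ, 1 < p n) (a b : ℕ) (ha : 1 ≤ a)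
    (q : ℕ → ℝ) (hq : ∀ x : ℕ, q x = p (a * x + b))
    (X : ℕ → ℕ) (ψ : ℕ →. ℕ) (hψ : LinearlyUniversal ψ)
    (hX : ∀ x : ℕ, X x ∉ ψ x ∧ ((X x : ℝ) < q x))
    (X' : ℕ → ℕ)
    (hX'₁ : ∀ x : ℕ, X' (a * x + b) = X x)
    (hX'₂ : ∀ y : ℕ, (¬ ∃ x : ℕ, y = a * x + b) → X' y = 0) :
    (∀ y : ℕ, (X' y : ℝ) < p y) ∧
    (∃ ψ' : ℕ →. ℕ, LinearlyUniversal ψ' ∧ ∀ y : ℕ, X' y ∉ ψ' y) ∧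
    LUA p X' := by
  have hb : ∀ y : ℕ, (X' y : ℝ) < p y := by
    intro y
    by_cases h : ∃ x : ℕ, y = a * x + b
    · obtain ⟨x, rfl⟩ := h
      rw [hX'₁, ← hq]
      exact (hX x).2
    · rw [hX'₂ y h]
      have := hp y
      push_cast
      linarith
  have hdiv : ∀ x : ℕ, (a * x + b - b) / a = x := by
    intro x
    rw [Nat.add_sub_cancel, Nat.mul_div_cancel_left x ha]
  have hex : ∃ ψ' : ℕ →. ℕ, LinearlyUniversal ψ' ∧ ∀ y : ℕ, X' y ∉ ψ' y := by
    have hf : Primrec (fun y : ℕ => (y - b) / a) :=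
      Primrec.nat_div.comp (Primrec.nat_sub.comp Primrec.id (Primrec.const b)) (Primrec.const a)
    have hc : Primrec (fun y : ℕ => decide (y = a * ((y - b) / a) + b)) :=
      (Primrec.eq (α := ℕ)).decide.comp Primrec.id
        (Primrec.nat_add.comp (Primrec.nat_mul.comp (Primrec.const a) hf) (Primrec.const b))
    refine ⟨fun y => cond (decide (y = a * ((y - b) / a) + b)) (ψ ((y - b) / a)) Part.none,
      ⟨Partrec.cond hc.to_comp (hψ.1.comp hf.to_comp) Partrec.none, ?_⟩, ?_⟩
    · intro θ hθ
      obtain ⟨c, d, h⟩ := hψ.2 θ hθ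
      refine ⟨a * c, a * d + b, fun x => ?_⟩
      have e : a * c * x + (a * d + b) = a * (c * x + d) + b := by ring
      simp only [e, hdiv, h, decide_true, cond_true]
    · intro y hy
      change X' y ∈ cond (decide (y = a * ((y - b) / a) + b)) (ψ ((y - b) / a)) Part.none at hy
      by_cases h : y = a * ((y - b) / a) + b
      · rw [decide_eq_true h, cond_true] at hy
        have hx := hX'₁ ((y - b) / a)
        rw [← h] at hx
        rw [hx] at hy
        exact (hX _).1 hy
      · rw [decide_eq_false h, cond_false] at hy
        exact Part.notMem_none _ hy
  refine ⟨hb, hex, ?_⟩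
  obtain ⟨ψ', h1, h2⟩ := hex
  exact ⟨ψ', h1, fun n => ⟨h2 n, hb n⟩⟩
end

section
/- Let ⟨p_k⟩_{k ∈ ℕ} be a sequence of slow-growing order functions, i.e., each p_k : ℕ → ℝ is positive, nondecreasing, unbounded, and the series ∑_n 1/p_k(n) diverges (fun n => 1/p_k(n) is not Summable). Then there exists a slow-growing order function q : ℕ → ℝ (positive, nondecreasing, unbounded, with ∑_n 1/q(n) divergent) such that for every k ∈ ℕ, q(n) ≤ p_k(n) for all but finitely many n. -/
/-- Given a sequence of slow-growing order functions, there is a slow-growing order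
function eventually below every member of the sequence. -/
theorem slow_growing_lower_bound
    (p : ℕ → ℕ → ℝ)
    (hpos : ∀ k n : ℕ, 0 < p k n)
    (hmono : ∀ k : ℕ, Monotone (p k))
    (hunbdd : ∀ k : ℕ, ∀ C : ℝ, ∃ n : ℕ, C < p k n)
    (hslow : ∀ k : ℕ, ¬ Summable (fun n : ℕ => 1 / p k n)) :
    ∃ q : ℕ → ℝ,
      (∀ n : ℕ, 0 < q n) ∧ Monotone q ∧ (∀ C : ℝ, ∃ n : ℕ, C < q n) ∧
      ¬ Summable (fun n : ℕ => 1 / q n) ∧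
      ∀ k : ℕ, ∀ᶠ n in Filter.atTop, q n ≤ p k n := by
  have hbdd : ∀ n, BddBelow (Set.range fun k : ℕ => max (p k n) ((k : ℝ) + 1)) := by
    intro n
    refine ⟨0, ?_⟩
    rintro _ ⟨k, rfl⟩
    exact le_max_of_le_left (hpos k n).le
  have hq1 : ∀ n, (1 : ℝ) ≤ ⨅ k : ℕ, max (p k n) ((k : ℝ) + 1) := by
    intro n
    refine le_ciInf fun k => le_max_of_le_right ?_
    have : (0 : ℝ) ≤ k := Nat.cast_nonneg k
    linarith
  have hev : ∀ k : ℕ, ∀ᶠ n in Filter.atTop,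
      (⨅ k : ℕ, max (p k n) ((k : ℝ) + 1)) ≤ p k n := by
    intro k
    obtain ⟨N, hN⟩ := hunbdd k ((k : ℝ) + 1)
    filter_upwards [Filter.eventually_ge_atTop N] with n hn
    refine (ciInf_le (hbdd n) k).trans (max_le le_rfl ?_)
    exact hN.le.trans (hmono k hn)
  refine ⟨fun n => ⨅ k : ℕ, max (p k n) ((k : ℝ) + 1),
    fun n => lt_of_lt_of_le one_pos (hq1 n), ?_, ?_, ?_, hev⟩
  · intro a b hab
    exact ciInf_mono (hbdd a) fun k => max_le_max (hmono k hab) le_rfl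
  · intro C
    obtain ⟨M, hM⟩ := exists_nat_gt C
    choose N hN using fun k => hunbdd k (M : ℝ)
    refine ⟨(Finset.range M).sup N, hM.trans_le (le_ciInf fun k => ?_)⟩
    by_cases hk : k < M
    · refine le_max_of_le_left ((hN k).le.trans (hmono k ?_))
      exact Finset.le_sup (f := N) (Finset.mem_range.2 hk)
    · refine le_max_of_le_right ?_
      have : (M : ℝ) ≤ k := by exact_mod_cast not_lt.1 hk
      linarith
  · intro hs
    refine hslow 0 (Summable.of_norm_bounded_eventually_nat hs ?_)
    filter_upwards [hev 0] with n hn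
    rw [Real.norm_of_nonneg (one_div_nonneg.2 (hpos 0 n).le)]
    exact one_div_le_one_div_of_le (lt_of_lt_of_le one_pos (hq1 n)) hn
end

section
/- Let ⟨p_k⟩_{k ∈ ℕ} be a sequence of slow-growing order functions (each p_k : ℕ → ℝ positive, nondecreasing, unbounded, with ∑_n 1/p_k(n) divergent), and suppose additionally that for each k, p_k(n) ≤ p_{k+1}(n) for all but finitely many n. Then there exists a slow-growing order function q : ℕ → ℝ (positive, nondecreasing, unbounded, with ∑_n 1/q(n) divergent) such that for every k ∈ ℕ, p_k(n) ≤ q(n) for all but finitely many n. -/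
/-- Given a sequence of slow-growing order functions in which each member eventually
bounds the previous one, there is a slow-growing order function eventually above
every member of the sequence. -/
theorem slow_growing_upper_bound
    (p : ℕ → ℕ → ℝ)
    (hpos : ∀ k n : ℕ, 0 < p k n)
    (hmono : ∀ k : ℕ, Monotone (p k))
    (hunbdd : ∀ k : ℕ, ∀ C : ℝ, ∃ n : ℕ, C < p k n)
    (hslow : ∀ k : ℕ, ¬ Summable (fun n : ℕ => 1 / p k n))
    (hchain : ∀ k : ℕ, ∀ᶠ n in Filter.atTop, p k n ≤ p (k + 1) n) :
    ∃ q : ℕ → ℝ,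
      (∀ n : ℕ, 0 < q n) ∧ Monotone q ∧ (∀ C : ℝ, ∃ n : ℕ, C < q n) ∧
      ¬ Summable (fun n : ℕ => 1 / q n) ∧
      ∀ k : ℕ, ∀ᶠ n in Filter.atTop, p k n ≤ q n := by
  have step : ∀ k M : ℕ, ∃ M' : ℕ, M < M' ∧ (∀ n, M' ≤ n → p k n ≤ p (k + 1) n) ∧
      1 ≤ ∑ n ∈ Finset.Ico M M', 1 / p k n := by
    intro k M
    have ht := (not_summable_iff_tendsto_nat_atTop_of_nonneg
      (fun n => (one_div_pos.2 (hpos k n)).le)).1 (hslow k)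
    have h1 := ht.eventually_ge_atTop (1 + ∑ n ∈ Finset.range M, 1 / p k n)
    have h2 := Filter.eventually_forall_ge_atTop.2 (hchain k)
    obtain ⟨M', a, b, c⟩ := (h1.and (h2.and (Filter.eventually_gt_atTop M))).exists
    refine ⟨M', c, b, ?_⟩
    rw [Finset.sum_Ico_eq_sub _ c.le]
    linarith
  choose f hf1 hf2 hf3 using step
  let N : ℕ → ℕ := fun k => Nat.rec 0 (fun k M => f k M) k
  have N0 : N 0 = 0 := rfl
  have NS : ∀ k, N (k + 1) = f k (N k) := fun k => rfl
  clear_value N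
  have Nmono : StrictMono N := strictMono_nat_of_lt_succ (fun k => by rw [NS]; exact hf1 _ _)
  have chain : ∀ n j m, j ≤ m → N m ≤ n → p j n ≤ p m n := by
    intro n j m hjm
    induction m, hjm using Nat.le_induction with
    | base => intro _; exact le_rfl
    | succ m hm ih =>
      intro h
      refine (ih ((Nmono m.lt_succ_self).le.trans h)).trans (hf2 m (N m) n ?_)
      rw [← NS]; exact h
  let K : ℕ → ℕ := fun n => Nat.findGreatest (fun k => N k ≤ n) n
  have K1 : ∀ n, N (K n) ≤ n := fun n =>
    Nat.findGreatest_spec (P := fun k => N k ≤ n) (Nat.zero_le n) (by simp [N0])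
  have K2 : ∀ n j, N j ≤ n → j ≤ K n := fun n j h =>
    Nat.le_findGreatest ((Nmono.id_le j).trans h) h
  clear_value K
  have dom : ∀ n j, N j ≤ n → p j n ≤ p (K n) n := fun n j h => chain n j _ (K2 n j h) (K1 n)
  refine ⟨fun n => p (K n) n, fun n => hpos _ _, ?_, ?_, ?_, ?_⟩
  · intro a b hab
    exact (hmono _ hab).trans (dom b _ ((K1 a).trans hab))
  · intro C
    obtain ⟨n, hn⟩ := hunbdd 0 C
    exact ⟨n, hn.trans_le (dom n 0 (by simp [N0]))⟩
  · intro hs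
    have key : ∀ k : ℕ, (k : ℝ) ≤ ∑ n ∈ Finset.range (N k), 1 / p (K n) n := by
      intro k
      induction k with
      | zero => simp [N0]
      | succ k ih =>
        have hle := (Nmono k.lt_succ_self).le
        rw [← Finset.sum_range_add_sum_Ico _ hle]
        have h3 := hf3 k (N k)
        rw [← NS] at h3
        have : ∑ n ∈ Finset.Ico (N k) (N (k + 1)), 1 / p (K n) n
            = ∑ n ∈ Finset.Ico (N k) (N (k + 1)), 1 / p k n := by
          refine Finset.sum_congr rfl fun n hn => ?_
          rw [Finset.mem_Ico] at hn
          have e : K n = k := by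
            refine le_antisymm ?_ (K2 n k hn.1)
            exact Nat.lt_succ_iff.1 (Nmono.lt_iff_lt.1 ((K1 n).trans_lt hn.2))
          rw [e]
        push_cast
        simp only [Nat.succ_eq_add_one]
        linarith
    obtain ⟨k, hk⟩ := exists_nat_gt (∑' n, 1 / p (K n) n)
    have := hs.sum_le_tsum (Finset.range (N k)) (fun n _ => (one_div_pos.2 (hpos _ n)).le)
    linarith [key k]
  · intro k
    filter_upwards [Filter.eventually_ge_atTop (N k)] with n hn
    exact dom n k hn
end

section
/- There exist slow-growing order functions p₁, p₂ : ℕ → ℝ (each positive, nondecreasing, unbounded, with ∑_n 1/p_i(n) divergent) such that max(p₁(n), p₂(n)) = n² for all n ≥ 1. Consequently, every function q : ℕ → ℝ that dominates both p₁ and p₂ (i.e., p₁(n) ≤ q(n) and p₂(n) ≤ q(n) for all but finitely many n) satisfies that ∑_n 1/q(n) converges; in particular no slow-growing order function dominates both p₁ and p₂. -/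
def sgA : ℕ → ℕ
  | 0 => 1
  | k + 1 => sgA k + sgA k ^ 2

def sgS (r : ℕ) (m : ℕ) : Prop := ∃ k, k % 2 = r ∧ sgA k ≤ m ∧ m < sgA (k + 1)

open Classical in
noncomputable def sgP (r : ℕ) (n : ℕ) : ℝ := (max 1 (Nat.findGreatest (sgS r) n) : ℕ) ^ 2

lemma sgA_ge (k : ℕ) : k + 1 ≤ sgA k := by
  induction k with
  | zero => simp [sgA]
  | succ k ih => simp only [sgA]; nlinarith

lemma sgA_mono : Monotone sgA :=
  monotone_nat_of_le_succ fun k => by simp only [sgA]; omega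

lemma sgS_not {r k m : ℕ} (hk : k % 2 ≠ r) (h1 : sgA k ≤ m) (h2 : m < sgA (k + 1)) :
    ¬ sgS r m := by
  rintro ⟨j, hj, h3, h4⟩
  rcases lt_trichotomy j k with h | h | h
  · have := sgA_mono (show j + 1 ≤ k from h); omega
  · subst h; exact hk hj
  · have := sgA_mono (show k + 1 ≤ j from h); omega

lemma sgS_cover (k m : ℕ) (h1 : 1 ≤ m) (h2 : m < sgA k) : sgS 0 m ∨ sgS 1 m := by
  induction k with
  | zero => simp [sgA] at h2; omega
  | succ k ih =>
    by_cases h : m < sgA k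
    · exact ih h
    · rcases Nat.mod_two_eq_zero_or_one k with hk | hk
      · exact Or.inl ⟨k, hk, by omega, h2⟩
      · exact Or.inr ⟨k, hk, by omega, h2⟩

lemma sgP_pos (r n : ℕ) : 0 < sgP r n := by
  classical
  unfold sgP
  have : 0 < max 1 (Nat.findGreatest (sgS r) n) := by omega
  positivity

lemma sgP_mono (r : ℕ) : Monotone (sgP r) := by
  classical
  intro a b h
  unfold sgP
  have : Nat.findGreatest (sgS r) a ≤ Nat.findGreatest (sgS r) b := Nat.findGreatest_mono_right _ h
  gcongr

lemma sgP_eq {r n : ℕ} (h1 : 1 ≤ n) (h : sgS r n) : sgP r n = (n : ℝ) ^ 2 := by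
  classical
  unfold sgP
  have : Nat.findGreatest (sgS r) n = n := Nat.findGreatest_eq_iff.2 ⟨le_rfl, fun _ => h, by omega⟩
  rw [this, max_eq_right h1]

lemma sgP_le {r n : ℕ} (h1 : 1 ≤ n) : sgP r n ≤ (n : ℝ) ^ 2 := by
  classical
  unfold sgP
  have : max 1 (Nat.findGreatest (sgS r) n) ≤ n := max_le h1 (Nat.findGreatest_le _)
  gcongr

lemma sgP_block {r k n : ℕ} (hk : k % 2 ≠ r) (h2 : n < sgA (k + 1)) :
    sgP r n ≤ (sgA k : ℝ) ^ 2 := by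
  classical
  unfold sgP
  have : max 1 (Nat.findGreatest (sgS r) n) ≤ sgA k := by
    apply max_le (by have := sgA_ge k; omega)
    by_contra! hlt
    have h0 : Nat.findGreatest (sgS r) n ≠ 0 := by omega
    have hs : sgS r (Nat.findGreatest (sgS r) n) := Nat.findGreatest_of_ne_zero rfl h0
    exact sgS_not hk hlt.le ((Nat.findGreatest_le _).trans_lt h2) hs
  gcongr

lemma sgP_unbdd {r : ℕ} (hr : r < 2) (C : ℝ) : ∃ n, C < sgP r n := by
  obtain ⟨N, hN⟩ := exists_nat_gt C
  have hk := sgA_ge (2 * N + r)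
  refine ⟨sgA (2 * N + r), ?_⟩
  rw [sgP_eq (by omega) ⟨2 * N + r, by omega, le_rfl, by simp only [sgA]; nlinarith⟩]
  have h : (N : ℝ) + 1 ≤ sgA (2 * N + r) := by exact_mod_cast (by omega : N + 1 ≤ sgA (2 * N + r))
  have : (0 : ℝ) ≤ N := by positivity
  nlinarith

lemma sgP_nsum {r : ℕ} (hr : r < 2) : ¬ Summable (fun n : ℕ => 1 / sgP r n) := by
  intro hs
  obtain ⟨N, hN⟩ := Metric.cauchySeq_iff.1 hs.tendsto_sum_tsum_nat.cauchySeq 1 one_pos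
  set k := 2 * N + (1 - r) with hkd
  have hk : k % 2 ≠ r := by omega
  have hge := sgA_ge k
  have hle : sgA k ≤ sgA (k + 1) := sgA_mono (by omega)
  have h := hN (sgA (k + 1)) (by omega) (sgA k) (by omega)
  rw [Real.dist_eq, ← Finset.sum_Ico_eq_sub _ hle] at h
  have h2 : ∑ n ∈ Finset.Ico (sgA k) (sgA (k + 1)), (1 / (sgA k : ℝ) ^ 2) ≤
      ∑ n ∈ Finset.Ico (sgA k) (sgA (k + 1)), 1 / sgP r n := by
    apply Finset.sum_le_sum
    intro n hn
    exact one_div_le_one_div_of_le (sgP_pos r n) (sgP_block hk (Finset.mem_Ico.1 hn).2)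
  have hpos : (0 : ℝ) < sgA k := by exact_mod_cast (by omega : 0 < sgA k)
  rw [Finset.sum_const, Nat.card_Ico, show sgA (k + 1) - sgA k = sgA k ^ 2 by simp [sgA],
    nsmul_eq_mul, Nat.cast_pow, mul_one_div_cancel (by positivity)] at h2
  have := le_abs_self (∑ n ∈ Finset.Ico (sgA k) (sgA (k + 1)), 1 / sgP r n)
  linarith

lemma sgP_max (n : ℕ) (h1 : 1 ≤ n) : max (sgP 0 n) (sgP 1 n) = (n : ℝ) ^ 2 := by
  rcases sgS_cover n n h1 (by have := sgA_ge n; omega) with h | h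
  · rw [sgP_eq h1 h]; exact max_eq_left (sgP_le h1)
  · rw [sgP_eq h1 h]; exact max_eq_right (sgP_le h1)

lemma sgP_dom (q : ℕ → ℝ) (hp : ∀ᶠ n in Filter.atTop, sgP 0 n ≤ q n)
    (hq : ∀ᶠ n in Filter.atTop, sgP 1 n ≤ q n) : Summable (fun n : ℕ => 1 / q n) := by
  refine Summable.of_norm_bounded_eventually_nat
    (Real.summable_one_div_nat_pow.2 (by norm_num : 1 < 2)) ?_
  filter_upwards [hp, hq, Filter.eventually_ge_atTop 1] with n h1 h2 h3
  have h : (n : ℝ) ^ 2 ≤ q n := by rw [← sgP_max n h3]; exact max_le h1 h2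
  have hn : (0 : ℝ) < (n : ℝ) ^ 2 := by positivity
  rw [Real.norm_of_nonneg (one_div_nonneg.2 (hn.le.trans h))]
  exact one_div_le_one_div_of_le hn h

/-- There are two slow-growing order functions whose pointwise maximum is `n ^ 2`;
consequently no slow-growing order function dominates both. -/
theorem no_slow_growing_upper_bound_in_general :
    ∃ p₁ p₂ : ℕ → ℝ,
      ((∀ n : ℕ, 0 < p₁ n) ∧ Monotone p₁ ∧ (∀ C : ℝ, ∃ n : ℕ, C < p₁ n) ∧
        ¬ Summable (fun n : ℕ => 1 / p₁ n)) ∧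
      ((∀ n : ℕ, 0 < p₂ n) ∧ Monotone p₂ ∧ (∀ C : ℝ, ∃ n : ℕ, C < p₂ n) ∧
        ¬ Summable (fun n : ℕ => 1 / p₂ n)) ∧
      (∀ n : ℕ, 1 ≤ n → max (p₁ n) (p₂ n) = (n : ℝ) ^ 2) ∧
      (∀ q : ℕ → ℝ,
        (∀ᶠ n in Filter.atTop, p₁ n ≤ q n) →
        (∀ᶠ n in Filter.atTop, p₂ n ≤ q n) →
        Summable (fun n : ℕ => 1 / q n)) ∧
      ¬ ∃ q : ℕ → ℝ,
          (∀ n : ℕ, 0 < q n) ∧ Monotone q ∧ (∀ C : ℝ, ∃ n : ℕ, C < q n) ∧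
          ¬ Summable (fun n : ℕ => 1 / q n) ∧
          (∀ᶠ n in Filter.atTop, p₁ n ≤ q n) ∧
          (∀ᶠ n in Filter.atTop, p₂ n ≤ q n) := by
  refine ⟨sgP 0, sgP 1, ⟨sgP_pos 0, sgP_mono 0, sgP_unbdd (by norm_num), sgP_nsum (by norm_num)⟩,
    ⟨sgP_pos 1, sgP_mono 1, sgP_unbdd (by norm_num), sgP_nsum (by norm_num)⟩,
    sgP_max, sgP_dom, ?_⟩
  rintro ⟨q, -, -, -, hns, h1, h2⟩
  exact hns (sgP_dom q h1 h2)
end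

section
/- Let ⟨p_k⟩_{k ∈ ℕ} be a sequence of fast-growing order functions, i.e., each p_k : ℕ → ℝ is positive, nondecreasing, and the series ∑_n 1/p_k(n) converges (fun n => 1/p_k(n) is Summable). Then there exists a fast-growing order function q : ℕ → ℝ (positive, nondecreasing, unbounded, with ∑_n 1/q(n) convergent) such that for every k ∈ ℕ, q(n) ≤ p_k(n) for all but finitely many n. -/
/-- Given a sequence of fast-growing order functions, there is a fast-growing order
function eventually below every member of the sequence. -/
theorem fast_growing_lower_bound
    (p : ℕ → ℕ → ℝ)
    (hpos : ∀ k n : ℕ, 0 < p k n)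
    (hmono : ∀ k : ℕ, Monotone (p k))
    (hfast : ∀ k : ℕ, Summable (fun n : ℕ => 1 / p k n)) :
    ∃ q : ℕ → ℝ,
      (∀ n : ℕ, 0 < q n) ∧ Monotone q ∧ (∀ C : ℝ, ∃ n : ℕ, C < q n) ∧
      Summable (fun n : ℕ => 1 / q n) ∧
      ∀ k : ℕ, ∀ᶠ n in Filter.atTop, q n ≤ p k n := by
  have hN : ∀ k : ℕ, ∃ N : ℕ, ∑' n, 1 / p k (max n N) < (1 / 2 : ℝ) ^ k := by
    intro k
    have h0 := (hfast k).tendsto_atTop_zero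
    have ht : Filter.Tendsto (fun N : ℕ => ∑' n, 1 / p k (max n N)) Filter.atTop
        (nhds (∑' _ : ℕ, (0 : ℝ))) := by
      refine tendsto_tsum_of_dominated_convergence (hfast k) ?_ ?_
      · intro n
        refine h0.comp (Filter.tendsto_atTop_mono (fun N => le_max_right n N) Filter.tendsto_id)
      · refine Filter.Eventually.of_forall fun N n => ?_
        rw [Real.norm_of_nonneg (one_div_pos.2 (hpos _ _)).le]
        exact one_div_le_one_div_of_le (hpos _ _) (hmono k (le_max_left _ _))
    rw [tsum_zero] at ht
    exact (ht.eventually (gt_mem_nhds (by positivity : (0 : ℝ) < (1 / 2 : ℝ) ^ k))).exists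
  choose N hN using hN
  have gpos : ∀ k n, 0 < 1 / p k (max n (N k)) := fun k n => one_div_pos.2 (hpos _ _)
  have gs : ∀ k, Summable fun n => 1 / p k (max n (N k)) := fun k =>
    Summable.of_nonneg_of_le (fun n => (gpos k n).le)
      (fun n => one_div_le_one_div_of_le (hpos _ _) (hmono k (le_max_left _ _))) (hfast k)
  have hS : Summable fun x : ℕ × ℕ => 1 / p x.1 (max x.2 (N x.1)) := by
    rw [summable_prod_of_nonneg (fun x => (gpos x.1 x.2).le)]
    refine ⟨gs, ?_⟩
    exact Summable.of_nonneg_of_le (fun k => tsum_nonneg fun n => (gpos k n).le)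
      (fun k => (hN k).le) (summable_geometric_of_lt_one (by norm_num) (by norm_num))
  have hS2 : Summable fun x : ℕ × ℕ => 1 / p x.2 (max x.1 (N x.2)) := hS.prod_symm
  rw [summable_prod_of_nonneg (fun x => (gpos x.2 x.1).le)] at hS2
  obtain ⟨hk, hb⟩ := hS2
  simp only at hk hb
  set b : ℕ → ℝ := fun n => ∑' k, 1 / p k (max n (N k)) with hbdef
  have bpos : ∀ n, 0 < b n := fun n => (hk n).tsum_pos (fun k => (gpos k n).le) 0 (gpos 0 n)
  refine ⟨fun n => 1 / b n, fun n => one_div_pos.2 (bpos n), ?_, ?_, ?_, ?_⟩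
  · intro m n hmn
    refine one_div_le_one_div_of_le (bpos n) ((hk n).tsum_le_tsum (fun k => ?_) (hk m))
    exact one_div_le_one_div_of_le (hpos _ _) (hmono k (max_le_max_right _ hmn))
  · intro C
    have h0 := hb.tendsto_atTop_zero
    obtain ⟨n, hn⟩ := (h0.eventually (gt_mem_nhds
      (by positivity : (0 : ℝ) < 1 / (|C| + 1)))).exists
    refine ⟨n, ?_⟩
    have h1 : |C| + 1 < 1 / b n := by
      rw [lt_one_div (by positivity) (bpos n)]
      exact hn
    have := le_abs_self C
    linarith
  · simpa only [one_div_one_div] using hb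
  · intro k
    filter_upwards [Filter.eventually_ge_atTop (N k)] with n hn
    rw [one_div_le (bpos n) (hpos k n)]
    have := (hk n).le_tsum k (fun j _ => (gpos j n).le)
    rwa [max_eq_left hn] at this
end

section
/- Let p : ℕ → ℝ be a fast-growing order function (positive, nondecreasing, with ∑_n 1/p(n) convergent). Then there exists a fast-growing order function q : ℕ → ℝ (positive, nondecreasing, unbounded, with ∑_n 1/q(n) convergent) such that the ratio p(n)/q(n) tends to infinity as n → ∞. -/
/-- Below every fast-growing order function `p` there is a fast-growing order
function `q` with `p n / q n → ∞`. -/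
theorem fast_growing_multiplicatively_infinite_lower_bound
    (p : ℕ → ℝ)
    (hpos : ∀ n : ℕ, 0 < p n)
    (hmono : Monotone p)
    (hfast : Summable (fun n : ℕ => 1 / p n)) :
    ∃ q : ℕ → ℝ,
      (∀ n : ℕ, 0 < q n) ∧ Monotone q ∧ (∀ C : ℝ, ∃ n : ℕ, C < q n) ∧
      Summable (fun n : ℕ => 1 / q n) ∧
      Filter.Tendsto (fun n : ℕ => p n / q n) Filter.atTop Filter.atTop := by
  obtain ⟨a, ha⟩ : ∃ a : ℕ → ℝ, a = fun n => 1 / p n := ⟨_, rfl⟩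
  rw [← ha] at hfast
  have apos : ∀ n, 0 < a n := fun n => by rw [ha]; exact one_div_pos.2 (hpos n)
  have aanti : ∀ m n, m ≤ n → a n ≤ a m := fun m n h => by
    rw [ha]; exact one_div_le_one_div_of_le (hpos m) (hmono h)
  have a0 := hfast.tendsto_atTop_zero
  have hlim : Filter.Tendsto (fun j : ℕ => ∑' n, min (a n) (1 / ((j : ℝ) + 1)))
      Filter.atTop (nhds (∑' _ : ℕ, (0 : ℝ))) := by
    refine tendsto_tsum_of_dominated_convergence hfast (fun n => ?_)
      (Filter.Eventually.of_forall fun j n => ?_)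
    · have h := (tendsto_const_nhds (x := a n)).min
        (tendsto_one_div_add_atTop_nhds_zero_nat (𝕜 := ℝ))
      rwa [min_eq_right (apos n).le] at h
    · rw [Real.norm_of_nonneg (le_min (apos n).le (by positivity))]
      exact min_le_left _ _
  rw [tsum_zero] at hlim
  have hex : ∀ k : ℕ, ∃ e : ℝ, 0 < e ∧ ∑' n, min (a n) e < (1 / 2 : ℝ) ^ k := by
    intro k
    obtain ⟨j, hj⟩ := (hlim.eventually_lt_const (u := (1 / 2 : ℝ) ^ k) (by positivity)).exists
    exact ⟨_, by positivity, hj⟩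
  choose e epos he using hex
  have hf0 : ∀ k n, 0 < min (a n) (e k) := fun k n => lt_min (apos n) (epos k)
  have hrow : ∀ k, Summable fun n => min (a n) (e k) := fun k =>
    Summable.of_nonneg_of_le (fun n => (hf0 k n).le) (fun n => min_le_left _ _) hfast
  have hS : Summable fun x : ℕ × ℕ => min (a x.2) (e x.1) := by
    refine (summable_prod_of_nonneg fun x => (hf0 x.1 x.2).le).2 ⟨hrow, ?_⟩
    exact Summable.of_nonneg_of_le (fun k => tsum_nonneg fun n => (hf0 k n).le)
      (fun k => (he k).le) summable_geometric_two
  have hcol : ∀ n, Summable fun k => min (a n) (e k) := fun n => hS.prod_symm.prod_factor n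
  have hb : Summable fun n => ∑' k, min (a n) (e k) := hS.prod_symm.prod
  obtain ⟨b, hbd⟩ : ∃ b : ℕ → ℝ, b = fun n => ∑' k, min (a n) (e k) := ⟨_, rfl⟩
  rw [← hbd] at hb
  have bpos : ∀ n, 0 < b n := fun n => by
    rw [hbd]; exact (hcol n).tsum_pos (fun k => (hf0 k n).le) 0 (hf0 0 n)
  have b0 : Filter.Tendsto b Filter.atTop (nhdsWithin 0 (Set.Ioi 0)) :=
    tendsto_nhdsWithin_iff.2 ⟨hb.tendsto_atTop_zero, Filter.Eventually.of_forall bpos⟩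
  refine ⟨fun n => (b n)⁻¹, fun n => inv_pos.2 (bpos n), fun m n h => ?_, fun C => ?_, ?_, ?_⟩
  · refine inv_anti₀ (bpos n) ?_
    rw [hbd]
    exact (hcol n).tsum_le_tsum (fun k => min_le_min_right _ (aanti m n h)) (hcol m)
  · exact (b0.inv_tendsto_nhdsGT_zero.eventually_gt_atTop C).exists
  · simpa using hb
  · refine Filter.tendsto_atTop.2 fun C => ?_
    obtain ⟨N, hN⟩ := exists_nat_ge C
    have hev : ∀ᶠ n in Filter.atTop, ∀ k ∈ Finset.range N, a n < e k :=
      (Finset.eventually_all _).2 fun k _ => a0.eventually_lt_const (epos k)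
    filter_upwards [hev] with n hn
    have h1 : (N : ℝ) * a n ≤ b n := by
      have h2 := (hcol n).sum_le_tsum (Finset.range N) (fun k _ => (hf0 k n).le)
      rw [Finset.sum_congr rfl fun k hk => min_eq_left (hn k hk).le] at h2
      rw [hbd]
      simpa using h2
    have h3 : a n * p n = 1 := by
      rw [ha]; exact one_div_mul_cancel (hpos n).ne'
    rw [div_inv_eq_mul]
    have h4 := mul_le_mul_of_nonneg_right h1 (hpos n).le
    rw [mul_assoc, h3] at h4
    linarith
end
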